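/- Let (𝒜, ℬ, 𝒞) be a recollement of abelian categories and let (ℰ, ℱ, 𝒢) be a τ-cotorsion torsion triple of ℬ. If i^* and i^! are exact, i_* i^!(ℰ ∩ ℱ) ⊆ ℰ ∩ ℱ, i_* i^*(ℰ ∩ ℱ) ⊆ ℰ ∩ ℱ, j_! j^*(ℰ ∩ ℱ) ⊆ ℰ ∩ ℱ, and j_* j^*(ℰ ∩ ℱ) ⊆ ℰ ∩ ℱ, then (^{⊥1}(Fac(i^*(ℰ ∩ ℱ))), Fac(i^*(ℰ ∩ ℱ)), (i^*(ℰ ∩ ℱ))^{⊥0}) is a τ-cotorsion torsion triple of 𝒜 and (^{⊥1}(Fac(j^*(ℰ ∩ ℱ))), Fac(j^*(ℰ ∩ ℱ)), (j^*(ℰ ∩ ℱ))^{⊥0}) is a τ-cotorsion torsion triple of 𝒞. -/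

import Mathlib

open CategoryTheory Limits Abelian

universe w₁ w₂ w₃ v₁ v₂ v₃ u₁ u₂ u₃

/-- A recollement of abelian categories. Exactness conditions on the six functors
(`i_*`, `j^*` exact; `i^*`, `j_!` right exact; `i^!`, `j_*` left exact) are automatic
from the adjunctions. -/
structure Recollement (𝒜 : Type u₁) (ℬ : Type u₂) (𝒞 : Type u₃)
    [Category.{v₁} 𝒜] [Category.{v₂} ℬ] [Category.{v₃} 𝒞]
    [Abelian 𝒜] [Abelian ℬ] [Abelian 𝒞] where
  /-- `i_* : 𝒜 ⥤ ℬ` -/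
  iStar : 𝒜 ⥤ ℬ
  /-- `i^* : ℬ ⥤ 𝒜` -/
  iUS : ℬ ⥤ 𝒜
  /-- `i^! : ℬ ⥤ 𝒜` -/
  iUE : ℬ ⥤ 𝒜
  /-- `j^* : ℬ ⥤ 𝒞` -/
  jUS : ℬ ⥤ 𝒞
  /-- `j_! : 𝒞 ⥤ ℬ` -/
  jLE : 𝒞 ⥤ ℬ
  /-- `j_* : 𝒞 ⥤ ℬ` -/
  jLS : 𝒞 ⥤ ℬ
  /-- the adjunction `(i^*, i_*)` -/
  adj₁ : iUS ⊣ iStar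
  /-- the adjunction `(i_*, i^!)` -/
  adj₂ : iStar ⊣ iUE
  /-- the adjunction `(j_!, j^*)` -/
  adj₃ : jLE ⊣ jUS
  /-- the adjunction `(j^*, j_*)` -/
  adj₄ : jUS ⊣ jLS
  iStar_full : iStar.Full
  iStar_faithful : iStar.Faithful
  jLE_full : jLE.Full
  jLE_faithful : jLE.Faithful
  jLS_full : jLS.Full
  jLS_faithful : jLS.Faithful
  /-- `Im i_* = Ker j^*` -/
  essImage_iStar : ∀ X : ℬ, iStar.essImage X ↔ IsZero (jUS.obj X)

variable {𝒟 : Type u₁} [Category.{v₁} 𝒟] [Abelian 𝒟]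

/-- a subcategory (given by a set of objects) closed under isomorphisms and (finite) direct
sums. -/
def IsGoodSubcat (S : Set 𝒟) : Prop :=
  (∀ ⦃X Y : 𝒟⦄, (X ≅ Y) → X ∈ S → Y ∈ S) ∧ ∀ X Y : 𝒟, X ∈ S → Y ∈ S → (X ⊞ Y) ∈ S

/-- exactness at `Y` of `X ⟶ Y ⟶ Z`. -/
def ExactAt {X Y Z : 𝒟} (f : X ⟶ Y) (g : Y ⟶ Z) : Prop :=
  ∃ w : f ≫ g = 0, (ShortComplex.mk f g w).Exact

section Ext
variable [HasExt.{w₁} 𝒟]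

/-- `⊥S`: objects `M` with `Ext^i(M, N) = 0` for all `i ≥ 1`, `N ∈ S`. -/
def leftPerp (S : Set 𝒟) : Set 𝒟 :=
  {M | ∀ N ∈ S, ∀ i : ℕ, 1 ≤ i → Subsingleton (Ext M N i)}

/-- a self-orthogonal subcategory. -/
def SelfOrthogonal (S : Set 𝒟) : Prop :=
  ∀ M ∈ S, ∀ N ∈ S, ∀ i : ℕ, 1 ≤ i → Subsingleton (Ext M N i)

/-- The subcategory `X_S` : objects `M ∈ ⊥S` admitting an exact sequence
`0 ⟶ M ⟶ W 0 ⟶ W 1 ⟶ ⋯` with all `W i ∈ S` and images of differentials in `⊥S`. -/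
def wakClass (S : Set 𝒟) : Set 𝒟 :=
  {M | M ∈ leftPerp S ∧ ∃ (W : ℕ → 𝒟) (f : M ⟶ W 0) (d : ∀ n, W n ⟶ W (n + 1)),
    (∀ n, W n ∈ S) ∧ Mono f ∧ ExactAt f (d 0) ∧ (∀ n, ExactAt (d n) (d (n + 1))) ∧
    (∀ n, image (d n) ∈ leftPerp S)}

/-- a wakamatsu tilting subcategory. -/
def WakamatsuTilting (S : Set 𝒟) : Prop :=
  SelfOrthogonal S ∧ ∀ P : 𝒟, Projective P → P ∈ wakClass S

end Ext

/-- `Fac S`. -/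
def Fac (S : Set 𝒟) : Set 𝒟 :=
  {X | ∃ M ∈ S, ∃ f : M ⟶ X, Epi f}

/-- `f : A ⟶ M` is a left `S`-approximation of `A`. -/
def IsLeftApprox (S : Set 𝒟) {A M : 𝒟} (f : A ⟶ M) : Prop :=
  M ∈ S ∧ ∀ M' ∈ S, ∀ g : A ⟶ M', ∃ h : M ⟶ M', f ≫ h = g

/-- `f : M ⟶ A` is a right `S`-approximation of `A`. -/
def IsRightApprox (S : Set 𝒟) {M A : 𝒟} (f : M ⟶ A) : Prop :=
  M ∈ S ∧ ∀ M' ∈ S, ∀ g : M' ⟶ A, ∃ h : M' ⟶ M, h ≫ f = g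

/-- a contravariantly finite subcategory. -/
def ContravariantlyFinite (S : Set 𝒟) : Prop :=
  ∀ A : 𝒟, ∃ (M : 𝒟) (f : M ⟶ A), IsRightApprox S f

section Ext
variable [HasExt.{w₁} 𝒟]

/-- a weak support τ-tilting subcategory. -/
def WeakSupportTauTilting (S : Set 𝒟) : Prop :=
  (∀ M ∈ S, ∀ L ∈ Fac S, Subsingleton (Ext M L 1)) ∧
  ∀ P : 𝒟, Projective P → ∃ (M₀ M₁ : 𝒟) (f : P ⟶ M₀) (g : M₀ ⟶ M₁),
    M₀ ∈ S ∧ M₁ ∈ S ∧ Epi g ∧ ExactAt f g ∧ IsLeftApprox S f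

/-- a support τ-tilting subcategory. -/
def SupportTauTilting (S : Set 𝒟) : Prop :=
  WeakSupportTauTilting S ∧ ContravariantlyFinite S

/-- `^⊥₁ S`. -/
def perpOneLeft (S : Set 𝒟) : Set 𝒟 :=
  {A | ∀ M ∈ S, Subsingleton (Ext A M 1)}

end Ext

/-- `S^⊥₀`. -/
def perpZeroRight (S : Set 𝒟) : Set 𝒟 :=
  {A | ∀ M ∈ S, ∀ f : M ⟶ A, f = 0}

/-- a torsion pair. -/
def TorsionPair (T F : Set 𝒟) : Prop :=
  (∀ X ∈ T, ∀ Y ∈ F, ∀ f : X ⟶ Y, f = 0) ∧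
  ∀ B : 𝒟, ∃ (X Y : 𝒟) (f : X ⟶ B) (g : B ⟶ Y),
    X ∈ T ∧ Y ∈ F ∧ Mono f ∧ Epi g ∧ ExactAt f g

/-- a τ-cotorsion torsion triple. -/
def TauCotorsionTorsionTriple [HasExt.{w₁} 𝒟] (L D F : Set 𝒟) : Prop :=
  L = perpOneLeft D ∧
  (∀ P : 𝒟, Projective P → ∃ (D₀ C₀ : 𝒟) (f : P ⟶ D₀) (g : D₀ ⟶ C₀),
    D₀ ∈ L ∩ D ∧ C₀ ∈ L ∧ Epi g ∧ ExactAt f g ∧ IsLeftApprox D f) ∧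
  ContravariantlyFinite (L ∩ D) ∧ TorsionPair D F

/-- the closure under isomorphism of the image of a subcategory under a functor. -/
def imgCl {𝒟' : Type u₂} [Category.{v₂} 𝒟'] (F : 𝒟 ⥤ 𝒟') (S : Set 𝒟) : Set 𝒟' :=
  {X | ∃ Y ∈ S, Nonempty (F.obj Y ≅ X)}

section Helpers

variable {D : Type*} [Category D] [Abelian D]

lemma aux_exactAt_shortExact {X Y Z : D} {f : X ⟶ Y} {g : Y ⟶ Z} (hf : Mono f) (hg : Epi g)
    (h : ExactAt f g) : ∃ w : f ≫ g = 0, (ShortComplex.mk f g w).ShortExact := by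
  obtain ⟨w, hw⟩ := h
  exact ⟨w, ShortComplex.ShortExact.mk' hw hf hg⟩

lemma aux_kernel_shortExact {X Y : D} (p : X ⟶ Y) [Epi p] :
    (ShortComplex.mk (kernel.ι p) p (kernel.condition p)).ShortExact :=
  ShortComplex.ShortExact.mk' (ShortComplex.exact_of_f_is_kernel _ (kernelIsKernel p))
    inferInstance inferInstance

lemma aux_cokernel_shortExact {X Y : D} (p : X ⟶ Y) [Mono p] :
    (ShortComplex.mk p (cokernel.π p) (cokernel.condition p)).ShortExact :=
  ShortComplex.ShortExact.mk' (ShortComplex.exact_of_g_is_cokernel _ (cokernelIsCokernel p))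
    inferInstance inferInstance

section
variable [HasExt.{w₁} D]

lemma aux_lift {S : ShortComplex D} (hS : S.ShortExact) {X : D}
    (hX : Subsingleton (Ext X S.X₁ 1)) (k : X ⟶ S.X₃) : ∃ l : X ⟶ S.X₂, l ≫ S.g = k := by
  obtain ⟨x, hx⟩ := Ext.covariant_sequence_exact₃ X hS (Ext.mk₀ k) (zero_add 1)
    (Subsingleton.elim _ _)
  obtain ⟨l, rfl⟩ := (Ext.mk₀_bijective _ _).2 x
  refine ⟨l, (Ext.mk₀_bijective _ _).1 ?_⟩
  rw [← hx, Ext.mk₀_comp_mk₀]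

lemma aux_extend {S : ShortComplex D} (hS : S.ShortExact) {Y : D}
    (hY : Subsingleton (Ext S.X₃ Y 1)) (k : S.X₁ ⟶ Y) : ∃ l : S.X₂ ⟶ Y, S.f ≫ l = k := by
  obtain ⟨x, hx⟩ := Ext.contravariant_sequence_exact₁ hS Y (Ext.mk₀ k) (add_zero 1)
    (Subsingleton.elim _ _)
  obtain ⟨l, rfl⟩ := (Ext.mk₀_bijective _ _).2 x
  refine ⟨l, (Ext.mk₀_bijective _ _).1 ?_⟩
  rw [← hx, Ext.mk₀_comp_mk₀]

lemma aux_subsingleton_of_extend {S : ShortComplex D} (hS : S.ShortExact) {Y : D}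
    (hY : Subsingleton (Ext S.X₂ Y 1))
    (H : ∀ k : S.X₁ ⟶ Y, ∃ l : S.X₂ ⟶ Y, S.f ≫ l = k) : Subsingleton (Ext S.X₃ Y 1) := by
  refine subsingleton_of_forall_eq 0 fun x => ?_
  obtain ⟨y, rfl⟩ := Ext.contravariant_sequence_exact₃ hS Y x (Subsingleton.elim _ _) (add_zero 1)
  obtain ⟨k, rfl⟩ := (Ext.mk₀_bijective _ _).2 y
  obtain ⟨l, rfl⟩ := H k
  rw [← Ext.mk₀_comp_mk₀, hS.extClass_comp_assoc]

lemma aux_subsingleton_of_lift {S : ShortComplex D} (hS : S.ShortExact) {X : D}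
    (hX : Subsingleton (Ext X S.X₂ 1))
    (H : ∀ k : X ⟶ S.X₃, ∃ l : X ⟶ S.X₂, l ≫ S.g = k) : Subsingleton (Ext X S.X₁ 1) := by
  refine subsingleton_of_forall_eq 0 fun x => ?_
  obtain ⟨y, rfl⟩ := Ext.covariant_sequence_exact₁ X hS x (Subsingleton.elim _ _) (zero_add 1)
  obtain ⟨k, rfl⟩ := (Ext.mk₀_bijective _ _).2 y
  obtain ⟨l, rfl⟩ := H k
  rw [← Ext.mk₀_comp_mk₀, Ext.comp_assoc_of_second_deg_zero, hS.comp_extClass, Ext.comp_zero]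

/-- If every extension of `A` by `N` splits, then `Ext^1(A, N) = 0`. -/
lemma aux_subsingleton_of_split [EnoughProjectives D] {A N : D}
    (H : ∀ (E : D) (a : N ⟶ E) (b : E ⟶ A) (w : a ≫ b = 0),
      (ShortComplex.mk a b w).ShortExact → ∃ s : A ⟶ E, s ≫ b = 𝟙 A) :
    Subsingleton (Ext A N 1) := by
  have hS := aux_kernel_shortExact (Projective.π A)
  refine aux_subsingleton_of_extend hS
    (subsingleton_of_forall_eq 0 fun x => Ext.eq_zero_of_projective x) fun k => ?_
  dsimp at k ⊢
  let b : pushout k (kernel.ι (Projective.π A)) ⟶ A :=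
    pushout.desc 0 (Projective.π A) (by simp)
  have w : pushout.inl k (kernel.ι (Projective.π A)) ≫ b = 0 := pushout.inl_desc _ _ _
  have wb : pushout.inr k (kernel.ι (Projective.π A)) ≫ b = Projective.π A :=
    pushout.inr_desc _ _ _
  have hb : Epi b := by
    have : Epi (pushout.inr k (kernel.ι (Projective.π A)) ≫ b) := by rw [wb]; infer_instance
    exact epi_of_epi (pushout.inr k (kernel.ι (Projective.π A))) b
  have hex : (ShortComplex.mk _ b w).Exact := by
    refine ShortComplex.exact_of_g_is_cokernel _ ?_
    have hd : ∀ {Z : D} (t : pushout k (kernel.ι (Projective.π A)) ⟶ Z)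
        (_ : pushout.inl k (kernel.ι (Projective.π A)) ≫ t = 0),
        ∃ d : A ⟶ Z, b ≫ d = t := by
      intro Z t ht
      obtain ⟨d, hd⟩ := hS.exact.desc' (pushout.inr k (kernel.ι (Projective.π A)) ≫ t) (by
        dsimp
        rw [← pushout.condition_assoc, ht, comp_zero])
      dsimp at d hd
      refine ⟨d, pushout.hom_ext ?_ ?_⟩
      · rw [reassoc_of% w, zero_comp, ht]
      · rw [reassoc_of% wb, hd]
    exact CokernelCofork.IsColimit.ofπ _ _ (fun t ht => (hd t ht).choose)
      (fun t ht => (hd t ht).choose_spec)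
      (fun t ht m hm => by rw [← cancel_epi b, hm, (hd t ht).choose_spec])
  have hSE : (ShortComplex.mk _ b w).ShortExact := ShortComplex.ShortExact.mk' hex inferInstance hb
  obtain ⟨s, hs⟩ := H _ _ _ w hSE
  have σ := ShortComplex.Splitting.ofExactOfSection _ hex s hs hSE.mono_f
  refine ⟨pushout.inr k (kernel.ι (Projective.π A)) ≫ σ.r, ?_⟩
  have := σ.f_r
  dsimp at this
  rw [← pushout.condition_assoc, this, Category.comp_id]

/-- A support τ-tilting subcategory gives a τ-cotorsion torsion triple. -/
lemma aux_triple [EnoughProjectives D] (T : Set D) (h : SupportTauTilting T) :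
    TauCotorsionTorsionTriple (perpOneLeft (Fac T)) (Fac T) (perpZeroRight T) := by
  obtain ⟨⟨hext, happ⟩, hcf⟩ := h
  have hTF : ∀ M ∈ T, M ∈ Fac T := fun M hM => ⟨M, hM, 𝟙 M, inferInstance⟩
  have hTL : ∀ M ∈ T, M ∈ perpOneLeft (Fac T) ∩ Fac T := fun M hM => ⟨hext M hM, hTF M hM⟩
  refine ⟨rfl, ?_, ?_, ?_, ?_⟩
  · intro P hP
    obtain ⟨M₀, M₁, f, g, hM₀, hM₁, hg, hfg, hf⟩ := happ P hP
    refine ⟨M₀, M₁, f, g, hTL _ hM₀, (hTL _ hM₁).1, hg, hfg, hTF _ hM₀, ?_⟩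
    rintro X ⟨M, hM, p, hp⟩ k
    obtain ⟨l, hl⟩ := hf.2 M hM (Projective.factorThru k p)
    exact ⟨l ≫ p, by rw [← Category.assoc, hl, Projective.factorThru_comp]⟩
  · intro A
    obtain ⟨M, q, hM, hq⟩ := hcf A
    refine ⟨M, q, hTL _ hM, ?_⟩
    rintro X ⟨hXL, hXF⟩ k
    -- a right approximation of `X`, which splits
    obtain ⟨N, p, hN, hp⟩ := hcf X
    have hpe : Epi p := by
      obtain ⟨N', hN', p', hp'⟩ := hXF
      obtain ⟨l, hl⟩ := hp N' hN' p'
      have : Epi (l ≫ p) := by rw [hl]; exact hp'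
      exact epi_of_epi l p
    have hS := aux_kernel_shortExact p
    have hK : ∀ M' ∈ T, Subsingleton (Ext M' (kernel p) 1) := fun M' hM' =>
      aux_subsingleton_of_lift hS (hext M' hM' N (hTF N hN)) (fun k => hp M' hM' k)
    have hKF : kernel p ∈ Fac T := by
      obtain ⟨M₀, M₁, f, g, hM₀, hM₁, hg, ⟨w, hfg⟩, hf⟩ :=
        happ (Projective.over (kernel p)) inferInstance
      let π := Projective.π (kernel p)
      obtain ⟨l, hl⟩ := hf.2 N hN (π ≫ kernel.ι p)
      -- `im f ⟶ kernel p`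
      have h0 : kernel.ι f ≫ π = 0 := by
        rw [← cancel_mono (kernel.ι p), Category.assoc, ← hl, kernel.condition_assoc, zero_comp,
          zero_comp]
      have hI : (ShortComplex.mk (kernel.ι g) g (kernel.condition g)).ShortExact :=
        aux_kernel_shortExact g
      have hfe : Epi (kernel.lift g f w) := hfg.epi_kernelLift
      have hk : kernel.ι (kernel.lift g f w) ≫ π = 0 := by
        have : kernel.ι (kernel.lift g f w) ≫ f = 0 := by
          have h1 := kernel.condition_assoc (kernel.lift g f w) (kernel.ι g)
          rwa [kernel.lift_ι, zero_comp] at h1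
        rw [← kernel.lift_ι f _ this, Category.assoc, h0, comp_zero]
      obtain ⟨c, hc⟩ := (aux_kernel_shortExact (kernel.lift g f w)).exact.desc' π hk
      dsimp at c hc
      obtain ⟨d, hd⟩ := aux_extend hI (hK M₁ hM₁) c
      dsimp at d hd
      refine ⟨M₀, hM₀, d, ?_⟩
      have : Epi (f ≫ d) := by
        have : f ≫ d = π := by rw [← hc, ← hd, kernel.lift_ι_assoc]
        rw [this]; infer_instance
      exact epi_of_epi f d
    obtain ⟨s, hs⟩ := aux_lift hS (hXL _ hKF) (𝟙 X)
    dsimp at s hs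
    obtain ⟨l, hl⟩ := hq N hN (p ≫ k)
    exact ⟨s ≫ l, by rw [Category.assoc, hl, reassoc_of% hs]⟩
  · rintro X ⟨M, hM, p, hp⟩ Y hY f
    rw [← cancel_epi p, hY M hM (p ≫ f), comp_zero]
  · intro B
    obtain ⟨M, q, hM, hq⟩ := hcf B
    have hS := aux_cokernel_shortExact (Limits.image.ι q)
    have hIF : image q ∈ Fac T := ⟨M, hM, Limits.factorThruImage q, inferInstance⟩
    refine ⟨image q, cokernel (Limits.image.ι q), Limits.image.ι q, cokernel.π (Limits.image.ι q), hIF, ?_,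
      inferInstance, inferInstance, _, hS.exact⟩
    intro M' hM' k
    obtain ⟨l, hl⟩ := aux_lift hS (hext M' hM' _ hIF) k
    dsimp at l hl
    obtain ⟨m, hm⟩ := hq M' hM' l
    have h0 : q ≫ cokernel.π (Limits.image.ι q) = 0 := by
      have h1 : (Limits.factorThruImage q ≫ Limits.image.ι q) ≫
          cokernel.π (Limits.image.ι q) = 0 := by
        rw [Category.assoc, cokernel.condition, comp_zero]
      rwa [Limits.image.fac q] at h1
    rw [← hl, ← hm, Category.assoc, h0, comp_zero]

/-- The intersection in a τ-cotorsion torsion triple is support τ-tilting. -/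
lemma aux_supportTauTilting (L F G : Set D) (goodF : IsGoodSubcat F)
    (h : TauCotorsionTorsionTriple L F G) : SupportTauTilting (L ∩ F) := by
  obtain ⟨rfl, happ, hcf, hhom, htor⟩ := h
  have hquot : ∀ {X Y : D} (p : X ⟶ Y), Epi p → X ∈ F → Y ∈ F := by
    intro X Y p hp hX
    obtain ⟨Y₁, Y₂, f, g, h₁, h₂, hf, hg, w, hfg⟩ := htor Y
    have hg0 : g = 0 := by
      rw [← cancel_epi p, hhom X hX Y₂ h₂ (p ≫ g), comp_zero]
    have hfe : Epi f := hfg.epi_f hg0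
    have : IsIso f := isIso_of_mono_of_epi f
    exact goodF.1 (asIso f) h₁
  refine ⟨⟨?_, ?_⟩, hcf⟩
  · rintro M ⟨hM, -⟩ X ⟨N, hN, p, hp⟩
    exact hM X (hquot p hp hN.2)
  · intro P hP
    obtain ⟨D₀, C₀, f, g, hD, hC, hg, hfg, hf⟩ := happ P hP
    exact ⟨D₀, C₀, f, g, hD, ⟨hC, hquot g hg hD.2⟩, hg, hfg, hD, fun M hM k => hf.2 M hM.2 k⟩

end

/-- Transfer of support τ-tilting subcategories along a functor `G` with a fully faithful right
exact section `L` preserving projectives. -/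
lemma aux_transfer {B : Type*} [Category B] [Abelian B] [HasExt.{w₁} D] [HasExt.{w₂} B]
    [EnoughProjectives D]
    (S : Set B) (hS : SupportTauTilting S) (L : D ⥤ B) (G : B ⥤ D) [L.Full] [L.Faithful]
    [PreservesFiniteColimits L] [PreservesFiniteColimits G] (e : L ⋙ G ≅ 𝟭 D)
    (hL : ∀ P : D, Projective P → Projective (L.obj P))
    (hiso : ∀ ⦃X Y : B⦄, (X ≅ Y) → X ∈ S → Y ∈ S)
    (hLG : ∀ Y ∈ S, L.obj (G.obj Y) ∈ S) :
    SupportTauTilting (imgCl G S) := by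
  have : L.PreservesZeroMorphisms :=
    Functor.preservesZeroMorphisms_of_preserves_initial_object
  have : G.PreservesZeroMorphisms :=
    Functor.preservesZeroMorphisms_of_preserves_initial_object
  obtain ⟨⟨hext, happ⟩, hcf⟩ := hS
  have hLT : ∀ X ∈ imgCl G S, L.obj X ∈ S := by
    rintro X ⟨Y, hY, ⟨φ⟩⟩
    exact hiso (L.mapIso φ) (hLG Y hY)
  have hGS : ∀ Y ∈ S, G.obj Y ∈ imgCl G S := fun Y hY => ⟨Y, hY, ⟨Iso.refl _⟩⟩
  have he : ∀ {X Y : D} (k : X ⟶ Y), G.map (L.map k) = e.hom.app X ≫ k ≫ e.inv.app Y := by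
    intro X Y k
    have := e.hom.naturality k
    dsimp at this
    rw [← reassoc_of% this]
    simp
  refine ⟨⟨?_, ?_⟩, ?_⟩
  · rintro M hM N ⟨N', hN', p, hp⟩
    refine aux_subsingleton_of_split fun E a b w hab => ?_
    have hb : Epi b := hab.epi_g
    have hLex := hab.exact.map_of_epi_of_preservesCokernel L hb inferInstance
    have hLb : Epi (L.map b) := inferInstance
    have hw : L.map a ≫ L.map b = 0 := by rw [← L.map_comp, w, L.map_zero]
    have hlift : Epi (kernel.lift (L.map b) (L.map a) hw) := hLex.epi_kernelLift
    have hK : kernel (L.map b) ∈ Fac S :=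
      ⟨L.obj N', hLT N' hN', L.map p ≫ kernel.lift (L.map b) (L.map a) hw, inferInstance⟩
    obtain ⟨s, hs⟩ := aux_lift (aux_kernel_shortExact (L.map b))
      (hext _ (hLT M hM) _ hK) (𝟙 (L.obj M))
    dsimp at s hs
    refine ⟨L.preimage s, L.map_injective ?_⟩
    simp [hs]
  · intro P hP
    obtain ⟨M₀, M₁, f, g, hM₀, hM₁, hg, ⟨w, hfg⟩, hf⟩ := happ (L.obj P) (hL P hP)
    have hex := hfg.map_of_epi_of_preservesCokernel G hg inferInstance
    have hw : G.map f ≫ G.map g = 0 := by rw [← G.map_comp, w, G.map_zero]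
    have hw' : (e.inv.app P ≫ G.map f) ≫ G.map g = 0 := by rw [Category.assoc, hw, comp_zero]
    refine ⟨G.obj M₀, G.obj M₁, e.inv.app P ≫ G.map f, G.map g, hGS _ hM₀, hGS _ hM₁,
      inferInstance, ⟨hw', ?_⟩, hGS _ hM₀, ?_⟩
    · refine ShortComplex.exact_of_iso ?_ hex
      refine ShortComplex.isoMk (e.app P) (Iso.refl (G.obj M₀)) (Iso.refl (G.obj M₁)) ?_ ?_
      · simp [ShortComplex.map]
      · simp [ShortComplex.map]
    · intro X hX k
      obtain ⟨l, hl⟩ := hf.2 (L.obj X) (hLT X hX) (L.map k)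
      refine ⟨G.map l ≫ e.hom.app X, ?_⟩
      rw [Category.assoc, ← G.map_comp_assoc, hl, he]
      simp
  · intro A
    obtain ⟨M, q, hM, hq⟩ := hcf (L.obj A)
    refine ⟨G.obj M, G.map q ≫ e.hom.app A, hGS _ hM, ?_⟩
    intro X hX k
    obtain ⟨l, hl⟩ := hq (L.obj X) (hLT X hX) (L.map k)
    refine ⟨e.inv.app X ≫ G.map l, ?_⟩
    rw [Category.assoc, ← G.map_comp_assoc, hl, he]
    simp

end Helpers

/-- If `(ℰ, ℱ, 𝒢)` is a τ-cotorsion torsion triple of `ℬ`, `i^*` and `i^!` are exact, and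
`ℰ ∩ ℱ` is preserved (within itself) by `i_* i^!`, `i_* i^*`, `j_! j^*` and `j_* j^*`, then
`(^⊥₁(Fac(i^*(ℰ ∩ ℱ))), Fac(i^*(ℰ ∩ ℱ)), (i^*(ℰ ∩ ℱ))^⊥₀)` is a τ-cotorsion torsion triple
of `𝒜`, and similarly with `j^*` for `𝒞`. -/
theorem stmt_10
    {𝒜 : Type u₁} {ℬ : Type u₂} {𝒞 : Type u₃}
    [Category.{v₁} 𝒜] [Category.{v₂} ℬ] [Category.{v₃} 𝒞]
    [Abelian 𝒜] [Abelian ℬ] [Abelian 𝒞]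
    [EnoughProjectives 𝒜] [EnoughInjectives 𝒜]
    [EnoughProjectives ℬ] [EnoughInjectives ℬ]
    [EnoughProjectives 𝒞] [EnoughInjectives 𝒞]
    [HasExt.{w₁} 𝒜] [HasExt.{w₂} ℬ] [HasExt.{w₃} 𝒞]
    (R : Recollement 𝒜 ℬ 𝒞)
    (ℰ ℱ 𝒢 : Set ℬ)
    (goodE : IsGoodSubcat ℰ) (goodF : IsGoodSubcat ℱ) (goodG : IsGoodSubcat 𝒢)
    (h : TauCotorsionTorsionTriple ℰ ℱ 𝒢)
    [PreservesFiniteLimits R.iUS] [PreservesFiniteColimits R.iUS]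
    [PreservesFiniteLimits R.iUE] [PreservesFiniteColimits R.iUE]
    (h₁ : ∀ Y ∈ ℰ ∩ ℱ, R.iStar.obj (R.iUE.obj Y) ∈ ℰ ∩ ℱ)
    (h₂ : ∀ Y ∈ ℰ ∩ ℱ, R.iStar.obj (R.iUS.obj Y) ∈ ℰ ∩ ℱ)
    (h₃ : ∀ Y ∈ ℰ ∩ ℱ, R.jLE.obj (R.jUS.obj Y) ∈ ℰ ∩ ℱ)
    (h₄ : ∀ Y ∈ ℰ ∩ ℱ, R.jLS.obj (R.jUS.obj Y) ∈ ℰ ∩ ℱ) :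
    TauCotorsionTorsionTriple
      (perpOneLeft (Fac (imgCl R.iUS (ℰ ∩ ℱ))))
      (Fac (imgCl R.iUS (ℰ ∩ ℱ)))
      (perpZeroRight (imgCl R.iUS (ℰ ∩ ℱ))) ∧
    TauCotorsionTorsionTriple
      (perpOneLeft (Fac (imgCl R.jUS (ℰ ∩ ℱ))))
      (Fac (imgCl R.jUS (ℰ ∩ ℱ)))
      (perpZeroRight (imgCl R.jUS (ℰ ∩ ℱ))) := by
  have hS : SupportTauTilting (ℰ ∩ ℱ) := aux_supportTauTilting ℰ ℱ 𝒢 goodF h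
  have hiso : ∀ ⦃X Y : ℬ⦄, (X ≅ Y) → X ∈ ℰ ∩ ℱ → Y ∈ ℰ ∩ ℱ :=
    fun X Y φ hX => ⟨goodE.1 φ hX.1, goodF.1 φ hX.2⟩
  have := R.iStar_full
  have := R.iStar_faithful
  have := R.jLE_full
  have := R.jLE_faithful
  constructor
  · have : PreservesFiniteColimits R.iStar :=
      ⟨fun J _ _ => have := R.adj₂.leftAdjoint_preservesColimits; inferInstance⟩
    exact aux_triple _ (aux_transfer _ hS R.iStar R.iUS (asIso R.adj₁.counit)
      (fun P hP => R.adj₂.map_projective P hP) hiso h₂)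
  · have : PreservesFiniteColimits R.jLE :=
      ⟨fun J _ _ => have := R.adj₃.leftAdjoint_preservesColimits; inferInstance⟩
    have : PreservesFiniteColimits R.jUS :=
      ⟨fun J _ _ => have := R.adj₄.leftAdjoint_preservesColimits; inferInstance⟩
    exact aux_triple _ (aux_transfer _ hS R.jLE R.jUS (asIso R.adj₃.unit).symm
      (fun P hP => R.adj₃.map_projective P hP) hiso h₃)
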